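/- Let T be an ℝ-tree and let (Pₙ) be a sequence of points of T̂ converging in the observers' topology to a point P ∈ T̂. Then for every Q ∈ T̂, the closure of ⋃_{m≥0} ⋂_{n≥m} [Q,Pₙ] is a segment from Q whose second endpoint is P; that is, P = liminf_Q Pₙ. -/

import Mathlib

/-!
Common formalization framework for "ℝ-trees, dual laminations, and compact systems
of partial isometries" (Coulbois–Hilion–Lustig).
-/

open Set Filter Topology Pointwise

noncomputable section

namespace CHL

/-! ### ℝ-trees -/

/-- The metric betweenness segment `[x,y]`.  In an ℝ-tree this is exactly the unique
topological arc joining `x` to `y`, which is a geodesic segment. -/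
def seg {T : Type*} [MetricSpace T] (x y : T) : Set T :=
  {z | dist x z + dist z y = dist x y}

/-- An ℝ-tree: a geodesic metric space which is `0`-hyperbolic (four point condition).
Equivalently, any two points are joined by a unique topological arc, and this arc is a
geodesic segment. -/
class IsRTree (T : Type*) [MetricSpace T] : Prop where
  geodesic : ∀ x y : T, ∃ f : ℝ → T, f 0 = x ∧ f (dist x y) = y ∧
      ∀ s ∈ Set.Icc (0 : ℝ) (dist x y), ∀ t ∈ Set.Icc (0 : ℝ) (dist x y),
        dist (f s) (f t) = |s - t|
  four_point : ∀ x y z w : T,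
      dist x y + dist z w ≤ max (dist x z + dist y w) (dist x w + dist y z)

/-- A subtree of an ℝ-tree: a convex subset. -/
def IsSubtree {T : Type*} [MetricSpace T] (A : Set T) : Prop :=
  ∀ x ∈ A, ∀ y ∈ A, seg x y ⊆ A

/-- A non-empty closed subtree. -/
def IsClosedSubtree {T : Type*} [MetricSpace T] (A : Set T) : Prop :=
  A.Nonempty ∧ IsClosed A ∧ IsSubtree A

/-- The convex hull of a subset of an ℝ-tree: the smallest subtree containing it. -/
def subtreeHull {T : Type*} [MetricSpace T] (S : Set T) : Set T :=
  ⋂₀ {A : Set T | S ⊆ A ∧ IsSubtree A}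

/-- A finite tree: the convex hull of finitely many points. -/
def IsFiniteSubtree {T : Type*} [MetricSpace T] (A : Set T) : Prop :=
  ∃ F : Finset T, A = subtreeHull (F : Set T)

/-- `[x,x']` is the segment joining `A` to `B`: its endpoints are the only points
in `A` resp. `B` that it meets. -/
def IsBridge {T : Type*} [MetricSpace T] (A B : Set T) (x x' : T) : Prop :=
  x ∈ A ∧ x' ∈ B ∧ seg x x' ∩ A = {x} ∧ seg x x' ∩ B = {x'}

/-- A morphism of ℝ-trees: a continuous map such that every segment is mapped locally
injectively except at finitely many points. -/
def IsTreeMorphism {T T' : Type*} [MetricSpace T] [MetricSpace T'] (f : T → T') : Prop :=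
  Continuous f ∧ ∀ x y : T, ∃ F : Finset T, ∀ p ∈ seg x y, p ∉ (F : Set T) →
    ∃ U ∈ nhdsWithin p (seg x y), Set.InjOn f U

/-- The translation length `‖g‖_T = inf_{x ∈ T} d(x, gx)`. -/
def translationLength (G : Type*) [Group G] (T : Type*) [MetricSpace T] [MulAction G T]
    (g : G) : ℝ :=
  ⨅ x : T, dist x (g • x)

/-- The translation length of `g` on an invariant subtree `A`. -/
def translationLengthOn {G : Type*} [Group G] {T : Type*} [MetricSpace T] [MulAction G T]
    (A : Set T) (g : G) : ℝ :=
  ⨅ x : A, dist (x : T) (g • (x : T))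

/-- The minimal `G`-invariant subtree. -/
def minSubtree (G : Type*) [Group G] (T : Type*) [MetricSpace T] [MulAction G T] : Set T :=
  ⋂₀ {A : Set T | A.Nonempty ∧ IsSubtree A ∧ ∀ g : G, ∀ x ∈ A, g • x ∈ A}

/-! ### Free groups, reduced words and the boundary `∂F(𝒜)` -/

/-- Two letters of `𝒜^{±1}` are inverse to each other. -/
def LettersInv {ι : Type*} (a b : ι × Bool) : Prop := a.1 = b.1 ∧ a.2 = !b.2

/-- The prefix of length `n` of (the reduced word of) `w`. -/
def gprefix {ι : Type*} [DecidableEq ι] (w : FreeGroup ι) (n : ℕ) : FreeGroup ι :=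
  FreeGroup.mk (w.toWord.take n)

/-- An infinite reduced word in the letters `𝒜^{±1}`: a point of the Gromov boundary
`∂F(𝒜)` of the free group `F(𝒜)`. -/
structure InfWord (ι : Type*) where
  letter : ℕ → ι × Bool
  reduced : ∀ n, ¬ LettersInv (letter n) (letter (n + 1))

/-- The prefix `X_n` of length `n` of an infinite reduced word `X`. -/
def InfWord.prefixN {ι : Type*} (X : InfWord ι) (n : ℕ) : FreeGroup ι :=
  FreeGroup.mk (List.ofFn fun i : Fin n => X.letter i)

/-- The infinite word `X_k⁻¹ X` obtained by deleting the first `k` letters. -/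
def InfWord.shift {ι : Type*} (X : InfWord ι) (k : ℕ) : InfWord ι :=
  ⟨fun n => X.letter (k + n), fun n => X.reduced (k + n)⟩

/-- A sequence `wₙ ∈ F(𝒜)` converges in `F(𝒜) ∪ ∂F(𝒜)` to the infinite word `X` iff
the length of the maximal common prefix of `wₙ` and `X` tends to infinity. -/
def TendstoBoundary {ι : Type*} [DecidableEq ι] (w : ℕ → FreeGroup ι) (X : InfWord ι) : Prop :=
  ∀ k : ℕ, ∀ᶠ n in atTop, (w n).toWord.take k = List.ofFn fun i : Fin k => X.letter i

/-- `Y = w · X` for the left action of `F(𝒜)` on its boundary `∂F(𝒜)`. -/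
def SmulBoundary {ι : Type*} [DecidableEq ι] (w : FreeGroup ι) (X Y : InfWord ι) : Prop :=
  TendstoBoundary (fun n => w * X.prefixN n) Y

/-- The (Cantor set) topology on `∂F(𝒜)`, induced by the product topology on sequences
of letters. -/
instance {ι : Type*} : TopologicalSpace (InfWord ι) :=
  TopologicalSpace.induced (fun X => X.letter)
    (@Pi.topologicalSpace ℕ (fun _ => ι × Bool) fun _ => ⊥)

/-- A non-trivial element of `F(𝒜)` is cyclically reduced if the first letter of its reduced
word is not the inverse of its last letter. -/
def IsCyclicallyReduced {ι : Type*} [DecidableEq ι] (w : FreeGroup ι) : Prop :=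
  w ≠ 1 ∧ ∀ a ∈ w.toWord.head?, ∀ b ∈ w.toWord.getLast?, ¬ LettersInv a b

/-- The dual laminary language `ℒ_𝒜(T)` of an isometric action of `F(𝒜)` on `T`. -/
def dualLanguage (ι : Type*) [DecidableEq ι] (T : Type*) [MetricSpace T]
    [MulAction (FreeGroup ι) T] : Set (FreeGroup ι) :=
  {v | ∀ ε > (0 : ℝ), ∃ u w : FreeGroup ι,
      (u * v * w).toWord = u.toWord ++ v.toWord ++ w.toWord ∧
      IsCyclicallyReduced (u * v * w) ∧
      translationLength (FreeGroup ι) T (u * v * w) < ε}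

/-- The dual laminary language `ℒ_𝒜(T)`, for the action restricted to an invariant
subtree `A`. -/
def dualLanguageOn (ι : Type*) [DecidableEq ι] {T : Type*} [MetricSpace T]
    [MulAction (FreeGroup ι) T] (A : Set T) : Set (FreeGroup ι) :=
  {v | ∀ ε > (0 : ℝ), ∃ u w : FreeGroup ι,
      (u * v * w).toWord = u.toWord ++ v.toWord ++ w.toWord ∧
      IsCyclicallyReduced (u * v * w) ∧
      translationLengthOn A (u * v * w) < ε}

/-! ### Systems of isometries on a compact ℝ-tree -/

/-- A system of isometries `𝒦 = (K, 𝒜)`: a family, indexed by `ι`, of non-empty partial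
isometries of the compact ℝ-tree `K`, i.e. isometries between non-empty closed subtrees. -/
structure SystemOfIsometries (K : Type*) [MetricSpace K] (ι : Type*) where
  pe : ι → PartialEquiv K K
  isom : ∀ i, ∀ x ∈ (pe i).source, ∀ y ∈ (pe i).source, dist (pe i x) (pe i y) = dist x y
  source_subtree : ∀ i, IsClosedSubtree (pe i).source
  target_subtree : ∀ i, IsClosedSubtree (pe i).target

namespace SystemOfIsometries

variable {K : Type*} [MetricSpace K] {ι : Type*} (S : SystemOfIsometries K ι)

/-- The partial isometry associated to a letter in `𝒜^{±1}`. -/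
def letterPE : ι × Bool → PartialEquiv K K
  | (i, true) => S.pe i
  | (i, false) => (S.pe i).symm

/-- The partial isometry `z₁ ∘ z₂ ∘ ⋯ ∘ zₙ` (acting on the right: first `z₁`, then `z₂`, …)
associated to the reduced word `w = z₁ ⋯ zₙ ∈ F(𝒜)`. -/
def wordPE [DecidableEq ι] (w : FreeGroup ι) : PartialEquiv K K :=
  (w.toWord.map S.letterPE).foldl PartialEquiv.trans (PartialEquiv.refl K)

/-- The domain `dom (w)` of the partial isometry associated to `w`. -/
def dom [DecidableEq ι] (w : FreeGroup ι) : Set K := (S.wordPE w).source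

/-- A word is admissible if it is non-empty as a partial isometry of `K`. -/
def Admissible [DecidableEq ι] (w : FreeGroup ι) : Prop := (S.dom w).Nonempty

/-- An infinite word is admissible if all its prefixes are admissible. -/
def AdmissibleInf [DecidableEq ι] (X : InfWord ι) : Prop := ∀ n, S.Admissible (X.prefixN n)

/-- The domain of an infinite word: the intersection of the domains of its prefixes. -/
def domInf [DecidableEq ι] (X : InfWord ι) : Set K := ⋂ n, S.dom (X.prefixN n)

/-- An infinite word `X` is eventually admissible if some suffix `X_k⁻¹ X` is admissible. -/
def EventuallyAdmissible [DecidableEq ι] (X : InfWord ι) : Prop :=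
  ∃ k, S.AdmissibleInf (X.shift k)

/-- The system `𝒦` has independent generators if the (non-empty) domain of every
admissible infinite word consists of exactly one point. -/
def IndependentGenerators [DecidableEq ι] : Prop :=
  ∀ X : InfWord ι, S.AdmissibleInf X → ∃ x : K, S.domInf X = {x}

/-- The admissible laminary language `ℒ_adm(𝒦)`: the largest laminary language consisting of
admissible words; `w ∈ ℒ_adm(𝒦)` iff for every `k` the word `w` is obtained from some
admissible word `v` by deleting its prefix and its suffix of length `k`. -/
def admLanguage [DecidableEq ι] : Set (FreeGroup ι) :=
  {w | ∀ k : ℕ, ∃ v : FreeGroup ι, S.Admissible v ∧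
      ∃ p s : List (ι × Bool), p.length = k ∧ s.length = k ∧
        v.toWord = p ++ w.toWord ++ s}

end SystemOfIsometries

/-- The ℝ-tree `T_𝒦` associated to a system of isometries `𝒦 = (K, 𝒜)`, presented through
its characteristic properties (Theorem 3.2 of the paper, by which it is unique):
`T_𝒦` contains `K` as an isometrically embedded subtree (1); the left action of `F(𝒜)`
is compatible with the partial isometries (2); every orbit meets `K`, and indeed every
segment is covered by finitely many translates of `K` (3); and `T_𝒦` is universal among
trees satisfying (1) and (2), via unique equivariant morphisms (4). -/
structure AssocTree {K : Type} [MetricSpace K] {ι : Type} [DecidableEq ι]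
    (S : SystemOfIsometries K ι) where
  carrier : Type
  [ms : MetricSpace carrier]
  tree : IsRTree carrier
  [act : MulAction (FreeGroup ι) carrier]
  act_isom : ∀ g : FreeGroup ι, Isometry fun x : carrier => g • x
  emb : K → carrier
  emb_isom : Isometry emb
  emb_subtree : IsSubtree (Set.range emb)
  compat : ∀ i : ι, ∀ x ∈ (S.pe i).source, (FreeGroup.of i)⁻¹ • emb x = emb (S.pe i x)
  orbit_meets : ∀ p : carrier, ∃ (w : FreeGroup ι) (x : K), p = w • emb x
  seg_cover : ∀ p q : carrier, ∃ F : Finset (FreeGroup ι),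
      seg p q ⊆ ⋃ w ∈ F, w • Set.range emb
  universal : ∀ (T' : Type) [MetricSpace T'] [MulAction (FreeGroup ι) T'],
      (∀ g : FreeGroup ι, Isometry fun x : T' => g • x) →
      ∀ e' : K → T', Isometry e' →
      (∀ i : ι, ∀ x ∈ (S.pe i).source, (FreeGroup.of i)⁻¹ • e' x = e' (S.pe i x)) →
      ∃! f : carrier → T', IsTreeMorphism f ∧
        (∀ (g : FreeGroup ι) (p : carrier), f (g • p) = g • f p) ∧
        ∀ x : K, f (emb x) = e' x

attribute [instance] AssocTree.ms AssocTree.act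

/-! ### Very small minimal actions with dense orbits, and their metric completion -/

/-- An ℝ-tree `T` (here: the subtree `Tsub` of the complete ℝ-tree `Tb`, whose metric
completion `T̄` is `Tb`) with a very small, minimal, isometric action of the free group
`F(𝒜)` with dense orbits.  (For actions with dense orbits, "very small" is equivalent to
"trivial arc stabilizers".) -/
structure TreeSetup (ι : Type) where
  Tb : Type
  [ms : MetricSpace Tb]
  complete : CompleteSpace Tb
  tree : IsRTree Tb
  [act : MulAction (FreeGroup ι) Tb]
  act_isom : ∀ g : FreeGroup ι, Isometry fun x : Tb => g • x
  Tsub : Set Tb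
  nonempty : Tsub.Nonempty
  dense : Dense Tsub
  sub_subtree : IsSubtree Tsub
  invariant : ∀ g : FreeGroup ι, ∀ x ∈ Tsub, g • x ∈ Tsub
  minimal : ∀ A : Set Tb, A ⊆ Tsub → A.Nonempty → IsSubtree A →
      (∀ g : FreeGroup ι, ∀ x ∈ A, g • x ∈ A) → A = Tsub
  dense_orbits : ∀ x ∈ Tsub, Tsub ⊆ closure (Set.range fun g : FreeGroup ι => g • x)
  arc_stab : ∀ g : FreeGroup ι, ∀ x ∈ Tsub, ∀ y ∈ Tsub, x ≠ y →
      (fun p => g • p) '' seg x y = seg x y → g = 1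

attribute [instance] TreeSetup.ms TreeSetup.act

/-- `𝒬(X) = Q` (for `Q ∈ T̄`), where `𝒬 : ∂F_N → T̂` is the map of Levitt–Lustig:
it is characterized by the property that whenever a sequence `uₙ ∈ F_N` converges to
`X ∈ ∂F_N` and `uₙ P` converges metrically in `T̄` to a point `Q`, then `𝒬(X) = Q`. -/
def QRel {ι : Type} [DecidableEq ι] (St : TreeSetup ι) (X : InfWord ι) (Q : St.Tb) : Prop :=
  ∃ P ∈ St.Tsub, ∃ u : ℕ → FreeGroup ι, TendstoBoundary u X ∧
    Tendsto (fun n => u n • P) atTop (𝓝 Q)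

/-- The limit set `Ω_𝒜 = 𝒬²(C²_𝒜 ∩ L²(T)) ⊆ T̄`: images of pairs of distinct boundary
points with distinct first letters (w.r.t. the basis `𝒜`) that are identified by `𝒬`. -/
def limitSet {ι : Type} [DecidableEq ι] (St : TreeSetup ι) : Set St.Tb :=
  {Q | ∃ X Y : InfWord ι, X.letter 0 ≠ Y.letter 0 ∧ QRel St X Q ∧ QRel St Y Q}

/-- The heart `K_𝒜 ⊆ T̄`: the convex hull of the limit set `Ω_𝒜`. -/
def heart {ι : Type} [DecidableEq ι] (St : TreeSetup ι) : Set St.Tb :=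
  subtreeHull (limitSet St)

/-- The dual algebraic lamination `L²(T) = {(X,Y) ∈ ∂²F_N : 𝒬(X) = 𝒬(Y)}`. -/
def L2 {ι : Type} [DecidableEq ι] (St : TreeSetup ι) : Set (InfWord ι × InfWord ι) :=
  {p | p.1 ≠ p.2 ∧ ∃ Q : St.Tb, QRel St p.1 Q ∧ QRel St p.2 Q}

/-! ### The system of isometries induced on a compact subtree `K ⊆ T̄` -/

/-- The domain, inside `T̄`, of the partial isometry `x ↦ w⁻¹ x` of `K` induced by the word
`w`: the intersection of the translates of `K` by the prefixes of `w`. -/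
def inducedDom {ι : Type} [DecidableEq ι] (St : TreeSetup ι) (K : Set St.Tb)
    (w : FreeGroup ι) : Set St.Tb :=
  ⋂ n ∈ Finset.range (w.toWord.length + 1), gprefix w n • K

/-- Admissibility of a word for the induced system of isometries `𝒦 = (K, 𝒜)`. -/
def InducedAdmissible {ι : Type} [DecidableEq ι] (St : TreeSetup ι) (K : Set St.Tb)
    (w : FreeGroup ι) : Prop :=
  (inducedDom St K w).Nonempty

/-- The admissible laminary language `ℒ_adm(𝒦)` of the induced system `𝒦 = (K, 𝒜)`. -/
def inducedAdmLanguage {ι : Type} [DecidableEq ι] (St : TreeSetup ι) (K : Set St.Tb) :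
    Set (FreeGroup ι) :=
  {w | ∀ k : ℕ, ∃ v : FreeGroup ι, InducedAdmissible St K v ∧
      ∃ p s : List (ι × Bool), p.length = k ∧ s.length = k ∧
        v.toWord = p ++ w.toWord ++ s}

/-- Admissibility of an infinite word for the induced system `𝒦 = (K, 𝒜)`. -/
def InducedAdmissibleInf {ι : Type} [DecidableEq ι] (St : TreeSetup ι) (K : Set St.Tb)
    (X : InfWord ι) : Prop :=
  ∀ n, InducedAdmissible St K (X.prefixN n)

/-- The domain `dom(X) = ⋂ₙ dom(Xₙ)` of an infinite word, for the induced system. -/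
def inducedDomInf {ι : Type} [DecidableEq ι] (St : TreeSetup ι) (K : Set St.Tb)
    (X : InfWord ι) : Set St.Tb :=
  ⋂ n, X.prefixN n • K

/-- Compatibility of a map `e : K → T'` with the system of partial isometries induced on
`K ⊆ T̄` by the basis `𝒜`: this is condition (2) of Theorem 3.2 for the induced system. -/
def InducedCompat {ι : Type} (St : TreeSetup ι) (K : Set St.Tb) {T' : Type} [MetricSpace T']
    [MulAction (FreeGroup ι) T'] (e : K → T') : Prop :=
  ∀ (i : ι) (x : K) (h : (FreeGroup.of i)⁻¹ • (x : St.Tb) ∈ K),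
    (FreeGroup.of i)⁻¹ • e x = e ⟨(FreeGroup.of i)⁻¹ • (x : St.Tb), h⟩

/-- The tree `T_𝒦` associated to the system of isometries induced on a compact subtree
`K ⊆ T̄`, presented through the characteristic properties of Theorem 3.2 (by which it is
unique), together with the canonical `F(𝒜)`-equivariant morphism `j : T_𝒦 → T̄` restricting
to the identity on `K`. -/
structure InducedAssoc {ι : Type} (St : TreeSetup ι) (K : Set St.Tb) where
  TK : Type
  [ms : MetricSpace TK]
  tree : IsRTree TK
  [act : MulAction (FreeGroup ι) TK]
  act_isom : ∀ g : FreeGroup ι, Isometry fun x : TK => g • x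
  emb : K → TK
  emb_isom : Isometry emb
  emb_subtree : IsSubtree (Set.range emb)
  compat : InducedCompat St K emb
  orbit_meets : ∀ p : TK, ∃ (w : FreeGroup ι) (x : K), p = w • emb x
  seg_cover : ∀ p q : TK, ∃ F : Finset (FreeGroup ι),
      seg p q ⊆ ⋃ w ∈ F, w • Set.range emb
  universal : ∀ (T' : Type) [MetricSpace T'] [MulAction (FreeGroup ι) T'],
      (∀ g : FreeGroup ι, Isometry fun x : T' => g • x) →
      ∀ e' : K → T', Isometry e' → InducedCompat St K e' →
      ∃! f : TK → T', IsTreeMorphism f ∧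
        (∀ (g : FreeGroup ι) (p : TK), f (g • p) = g • f p) ∧
        ∀ x : K, f (emb x) = e' x
  jmap : TK → St.Tb
  jmap_morphism : IsTreeMorphism jmap
  jmap_equivariant : ∀ (g : FreeGroup ι) (p : TK), jmap (g • p) = g • jmap p
  jmap_emb : ∀ x : K, jmap (emb x) = (x : St.Tb)

attribute [instance] InducedAssoc.ms InducedAssoc.act

/-! ### Change of basis -/

/-- Changing the basis of the free group: the same tree, with the action precomposed with
the automorphism `φ` of `F(𝒜)`.  The heart of `St.twist φ` is the heart of `T` with respect
to the basis `φ(𝒜)`. -/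
def TreeSetup.twist {ι : Type} (St : TreeSetup ι) (φ : FreeGroup ι ≃* FreeGroup ι) :
    TreeSetup ι where
  Tb := St.Tb
  ms := St.ms
  complete := St.complete
  tree := St.tree
  act := { smul := fun g x => φ g • x
           one_smul := fun x => by show φ 1 • x = x; rw [map_one, one_smul]
           mul_smul := fun g h x => by
             show φ (g * h) • x = φ g • φ h • x
             rw [map_mul, mul_smul] }
  act_isom := fun g => St.act_isom (φ g)
  Tsub := St.Tsub
  nonempty := St.nonempty
  dense := St.dense
  sub_subtree := St.sub_subtree
  invariant := fun g x hx => St.invariant (φ g) x hx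
  minimal := fun A hA hne hsub hinv => St.minimal A hA hne hsub (fun g x hx => by
    have h : φ (φ.symm g) • x ∈ A := hinv (φ.symm g) x hx
    rwa [MulEquiv.apply_symm_apply] at h)
  dense_orbits := fun x hx => by
    have hr : (Set.range fun g : FreeGroup ι => φ g • x) =
        Set.range fun g : FreeGroup ι => g • x := by
      apply Set.ext; intro y
      constructor
      · rintro ⟨g, rfl⟩; exact ⟨φ g, rfl⟩
      · rintro ⟨g, rfl⟩; exact ⟨φ.symm g, by simp⟩
    show St.Tsub ⊆ closure (Set.range fun g : FreeGroup ι => φ g • x)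
    rw [hr]; exact St.dense_orbits x hx
  arc_stab := fun g x hx y hy hxy him => by
    have h1 : φ g = 1 := St.arc_stab (φ g) x hx y hy hxy him
    have h2 := congrArg φ.symm h1
    simpa using h2

/-! ### The boundary `∂T`, the space `T̂ = T̄ ∪ ∂T` and the observers' topology -/

/-- An isometric ray (parametrized on `[0,∞)`) in a metric space. -/
def IsRay {T : Type} [MetricSpace T] (r : ℝ → T) : Prop :=
  ∀ s t : ℝ, 0 ≤ s → 0 ≤ t → dist (r s) (r t) = |s - t|

/-- The type of isometric rays in `T`. -/
def Ray (T : Type) [MetricSpace T] : Type := {r : ℝ → T // IsRay r}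

/-- Two rays define the same end iff they are at bounded distance. -/
def rayEnd (T : Type) [MetricSpace T] : Setoid (Ray T) where
  r := fun r₁ r₂ => ∃ C : ℝ, ∀ t : ℝ, 0 ≤ t → dist (r₁.1 t) (r₂.1 t) ≤ C
  iseqv := by
    refine ⟨fun r => ⟨0, fun t _ => by simp⟩, ?_, ?_⟩
    · rintro r₁ r₂ ⟨C, hC⟩
      exact ⟨C, fun t ht => by rw [dist_comm]; exact hC t ht⟩
    · rintro r₁ r₂ r₃ ⟨C, hC⟩ ⟨D, hD⟩
      exact ⟨C + D, fun t ht =>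
        (dist_triangle _ (r₂.1 t) _).trans (add_le_add (hC t ht) (hD t ht))⟩

/-- The Gromov boundary `∂T`: ends of `T`, i.e. classes of rays at bounded distance. -/
def GromovBoundary (T : Type) [MetricSpace T] : Type := Quotient (rayEnd T)

/-- The space `T̂ = T̄ ∪ ∂T` (for `T` a complete ℝ-tree, representing the completion `T̄`). -/
def TreeHat (T : Type) [MetricSpace T] : Type := T ⊕ GromovBoundary T

/-- The segment `[x, ξ]` from a point `x ∈ T̄` to a boundary point `ξ ∈ ∂T`. -/
def raySeg {T : Type} [MetricSpace T] (x : T) (ξ : GromovBoundary T) : Set (TreeHat T) :=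
  ({Sum.inr ξ} : Set (TreeHat T)) ∪ Sum.inl ''
    {p | ∃ r : Ray T, Quotient.mk (rayEnd T) r = ξ ∧ r.1 0 = x ∧ ∃ t : ℝ, 0 ≤ t ∧ r.1 t = p}

/-- The segment `[ξ, η]` between two boundary points. -/
def lineSeg {T : Type} [MetricSpace T] (ξ η : GromovBoundary T) : Set (TreeHat T) :=
  ({Sum.inr ξ, Sum.inr η} : Set (TreeHat T)) ∪ Sum.inl ''
    {p | ∃ r r' : Ray T, Quotient.mk (rayEnd T) r = ξ ∧ Quotient.mk (rayEnd T) r' = η ∧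
      r.1 0 = p ∧ r'.1 0 = p ∧ ∀ s t : ℝ, 0 ≤ s → 0 ≤ t → dist (r.1 s) (r'.1 t) = s + t}

/-- The segment `[P, Q]` between two points of `T̂ = T̄ ∪ ∂T`. -/
def segHat {T : Type} [MetricSpace T] : TreeHat T → TreeHat T → Set (TreeHat T)
  | Sum.inl x, Sum.inl y => Sum.inl '' seg x y
  | Sum.inl x, Sum.inr ξ => raySeg x ξ
  | Sum.inr ξ, Sum.inl x => raySeg x ξ
  | Sum.inr ξ, Sum.inr η => lineSeg ξ η

/-- The observers' topology on `T̂`: generated by the set of directions, where the direction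
at `P` containing `x` is the set of points `y` with `P ∉ [x,y]` (i.e. the connected component
of `T̂ ∖ {P}` containing `x`). -/
def observersTopology (T : Type) [MetricSpace T] : TopologicalSpace (TreeHat T) :=
  TopologicalSpace.generateFrom
    {D | ∃ P x : TreeHat T, x ≠ P ∧ D = {y | y ≠ P ∧ P ∉ segHat x y}}

/-- The extension to `T̂ = T̄ ∪ ∂T` of an isometric action on `T̄`. -/
def TreeHat.smul {T : Type} [MetricSpace T] {G : Type} [Group G] [MulAction G T]
    (hiso : ∀ g : G, Isometry fun x : T => g • x) (g : G) : TreeHat T → TreeHat T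
  | Sum.inl x => Sum.inl (g • x)
  | Sum.inr ξ => Sum.inr <| Quotient.map'
      (fun r : Ray T => (⟨fun t => g • r.1 t, fun s t hs ht => by
        have h := (hiso g).dist_eq (r.1 s) (r.1 t)
        simpa using h.trans (r.2 s t hs ht)⟩ : Ray T))
      (fun r r' h => by
        obtain ⟨C, hC⟩ := h
        exact ⟨C, fun t ht => by
          have h' := (hiso g).dist_eq (r.1 t) (r'.1 t)
          simpa using h'.le.trans (hC t ht)⟩) ξ

/-! ### Laminations -/

/-- An algebraic lamination (as a set of pairs of boundary points) is closed by diagonal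
leaves. -/
def ClosedByDiagonal {ι : Type} (L : Set (InfWord ι × InfWord ι)) : Prop :=
  ∀ X X' X'' : InfWord ι, (X, X') ∈ L → (X', X'') ∈ L → X = X'' ∨ (X, X'') ∈ L

/-- Invariance of a lamination under the `F(𝒜)`-action on `∂²F(𝒜)`. -/
def InvariantLam {ι : Type} [DecidableEq ι] (L : Set (InfWord ι × InfWord ι)) : Prop :=
  ∀ (w : FreeGroup ι) (X X' Y Y' : InfWord ι), (X, X') ∈ L →
    SmulBoundary w X Y → SmulBoundary w X' Y' → (Y, Y') ∈ L

/-- Invariance of a lamination under the flip map. -/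
def FlipInvariant {ι : Type} (L : Set (InfWord ι × InfWord ι)) : Prop :=
  ∀ X Y : InfWord ι, (X, Y) ∈ L → (Y, X) ∈ L

/-- The dual lamination `L²(T)` is minimal up to diagonal leaves: it contains no proper
non-trivial sublamination that is closed by diagonal leaves. -/
def MinimalUpToDiagonal {ι : Type} [DecidableEq ι] (St : TreeSetup ι) : Prop :=
  ∀ L : Set (InfWord ι × InfWord ι), L ⊆ L2 St → L.Nonempty → IsClosed L →
    InvariantLam L → FlipInvariant L → ClosedByDiagonal L → L = L2 St

end CHL

namespace CHL

/-! ### Segments in an ℝ-tree -/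

section Segments

variable {T : Type*} [MetricSpace T]

theorem mem_seg {x y z : T} : z ∈ seg x y ↔ dist x z + dist z y = dist x y := Iff.rfl

theorem seg_symm (x y : T) : seg x y = seg y x := by
  ext z
  rw [mem_seg, mem_seg, dist_comm x z, dist_comm z y, dist_comm x y, add_comm]

theorem mem_seg_of_mem_seg {p a b a' b' : T} (h : p ∈ seg a' b') (ha : a ∈ seg p a')
    (hb : b ∈ seg p b') : p ∈ seg a b := by
  rw [mem_seg] at *
  have h1 := dist_triangle a p b
  have h2 := dist_triangle4 a' a b b'
  rw [dist_comm a' p] at h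
  rw [dist_comm a p] at *
  rw [dist_comm a' a] at h2
  linarith

theorem seg_subset_union [IsRTree T] (x y z : T) : seg x z ⊆ seg x y ∪ seg y z := by
  intro p hp
  have h := IsRTree.four_point x z p y
  have h1 := dist_triangle x p y
  have h2 := dist_triangle z p y
  simp only [mem_union, mem_seg] at *
  rw [dist_comm y p, dist_comm y z]
  rw [dist_comm z p] at h h2
  rcases le_max_iff.1 h with h | h
  · right; linarith
  · left; linarith

theorem eq_of_mem_seg {a b m y : T} (hy : y ∈ seg a b) (ha : m ∈ seg y a) (hb : m ∈ seg y b) :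
    m = y := by
  rw [mem_seg] at *
  have h := dist_triangle a m b
  rw [dist_comm a y] at hy
  rw [dist_comm a m] at h
  have h0 : dist y m = 0 := le_antisymm (by linarith) dist_nonneg
  exact (dist_eq_zero.1 h0).symm

theorem exists_mem_seg_dist_eq [IsRTree T] {x y : T} {t : ℝ} (h0 : 0 ≤ t) (ht : t ≤ dist x y) :
    ∃ z ∈ seg x y, dist x z = t := by
  obtain ⟨f, hx, hy, hf⟩ := IsRTree.geodesic x y
  have h1 := hf 0 ⟨le_rfl, dist_nonneg⟩ t ⟨h0, ht⟩
  have h2 := hf t ⟨h0, ht⟩ _ ⟨dist_nonneg, le_rfl⟩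
  rw [hx, zero_sub, abs_neg, abs_of_nonneg h0] at h1
  rw [hy, abs_sub_comm, abs_of_nonneg (sub_nonneg.2 ht)] at h2
  exact ⟨f t, by rw [mem_seg]; linarith, h1⟩

theorem exists_median [IsRTree T] (x y z : T) :
    ∃ m, m ∈ seg x y ∧ m ∈ seg x z ∧ m ∈ seg y z := by
  obtain ⟨m, hm, hd⟩ := exists_mem_seg_dist_eq (x := x) (y := y)
    (t := (dist x y + dist x z - dist y z) / 2)
    (by linarith [dist_triangle y x z, dist_comm x y]) (by linarith [dist_triangle x y z])
  have h := IsRTree.four_point x y m z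
  have hx := dist_triangle x m z
  have hy := dist_triangle y m z
  rw [mem_seg] at hm
  rw [dist_comm y m] at h hy
  refine ⟨m, hm, ?_, ?_⟩ <;> rw [mem_seg]
  · rcases le_max_iff.1 h with h | h <;> linarith
  · rw [dist_comm y m]
    rcases le_max_iff.1 h with h | h <;> linarith

end Segments

variable {T : Type} [MetricSpace T]

/-! ### Rays -/

theorem IsRay.dist_zero {r : ℝ → T} (hr : IsRay r) {t : ℝ} (ht : 0 ≤ t) :
    dist (r 0) (r t) = t := by
  rw [hr 0 t le_rfl ht, zero_sub, abs_neg, abs_of_nonneg ht]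

theorem IsRay.dist_of_le {r : ℝ → T} (hr : IsRay r) {s t : ℝ} (hs : 0 ≤ s) (hst : s ≤ t) :
    dist (r s) (r t) = t - s := by
  rw [hr s t hs (hs.trans hst), abs_sub_comm, abs_of_nonneg (sub_nonneg.2 hst)]

theorem isRay_of_dist {r : ℝ → T}
    (h : ∀ s t : ℝ, 0 ≤ s → s ≤ t → dist (r s) (r t) = t - s) : IsRay r := by
  intro s t hs ht
  rcases le_total s t with hst | hst
  · rw [h s t hs hst, abs_sub_comm, abs_of_nonneg (sub_nonneg.2 hst)]
  · rw [dist_comm, h t s ht hst, abs_of_nonneg (sub_nonneg.2 hst)]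

theorem IsRay.mem_seg {r : ℝ → T} (hr : IsRay r) {s t : ℝ} (hs : 0 ≤ s) (hst : s ≤ t) :
    r s ∈ seg (r 0) (r t) := by
  rw [CHL.mem_seg, hr.dist_zero hs, hr.dist_zero (hs.trans hst), hr.dist_of_le hs hst]
  ring

theorem Ray.exists_shift (r : Ray T) {t : ℝ} (ht : 0 ≤ t) :
    ∃ r' : Ray T, Quotient.mk (rayEnd T) r' = Quotient.mk (rayEnd T) r ∧
      ∀ s, r'.1 s = r.1 (t + s) := by
  refine ⟨⟨fun s => r.1 (t + s), isRay_of_dist fun s u hs hsu => ?_⟩, ?_, fun s => rfl⟩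
  · rw [r.2.dist_of_le (by linarith) (by linarith)]
    ring
  · refine Quotient.sound ⟨t, fun s hs => ?_⟩
    rw [dist_comm, r.2.dist_of_le hs (by linarith)]
    linarith

theorem Ray.exists_concat [IsRTree T] (r : Ray T) {x : T}
    (h : ∀ t, 0 ≤ t → r.1 0 ∈ seg x (r.1 t)) :
    ∃ r' : Ray T, Quotient.mk (rayEnd T) r' = Quotient.mk (rayEnd T) r ∧ r'.1 0 = x ∧
      r'.1 (dist x (r.1 0)) = r.1 0 := by
  obtain ⟨f, hf0, hfd, hf⟩ := IsRTree.geodesic x (r.1 0)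
  set d := dist x (r.1 0) with hd
  have hd0 : 0 ≤ d := dist_nonneg
  have hr' : IsRay fun s => if s ≤ d then f s else r.1 (s - d) := by
    refine isRay_of_dist fun s t hs hst => ?_
    by_cases htd : t ≤ d
    · simp only [htd, hst.trans htd, if_true]
      rw [hf s ⟨hs, hst.trans htd⟩ t ⟨hs.trans hst, htd⟩, abs_sub_comm,
        abs_of_nonneg (sub_nonneg.2 hst)]
    · rw [not_le] at htd
      by_cases hsd : s ≤ d
      · simp only [htd.not_ge, hsd, if_true, if_false]
        have h1 := h (t - d) (by linarith)
        rw [CHL.mem_seg, r.2.dist_zero (by linarith), ← hd] at h1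
        have h2 := dist_triangle x (f s) (r.1 (t - d))
        have h3 := dist_triangle (f s) (r.1 0) (r.1 (t - d))
        have h4 := hf 0 ⟨le_rfl, hd0⟩ s ⟨hs, hsd⟩
        have h5 := hf s ⟨hs, hsd⟩ d ⟨hd0, le_rfl⟩
        rw [hf0, zero_sub, abs_neg, abs_of_nonneg hs] at h4
        rw [hfd, abs_sub_comm, abs_of_nonneg (sub_nonneg.2 hsd)] at h5
        rw [r.2.dist_zero (by linarith)] at h3
        linarith
      · simp only [htd.not_ge, hsd, if_false]
        rw [not_le] at hsd
        rw [r.2.dist_of_le (by linarith) (by linarith)]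
        ring
  refine ⟨⟨_, hr'⟩, Quotient.sound ⟨2 * d, fun t ht => ?_⟩, ?_, ?_⟩
  · have h1 := dist_triangle (if t ≤ d then f t else r.1 (t - d)) (r.1 0) (r.1 t)
    dsimp only
    split_ifs at h1 ⊢ with htd
    · have h5 := hf t ⟨ht, htd⟩ d ⟨hd0, le_rfl⟩
      rw [hfd, abs_sub_comm, abs_of_nonneg (sub_nonneg.2 htd)] at h5
      rw [r.2.dist_zero ht] at h1
      linarith
    · rw [not_le] at htd
      rw [r.2.dist_of_le (by linarith) (by linarith)]
      linarith
  · simp [hd0, hf0]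
  · simp [hfd]

theorem Ray.exists_from [IsRTree T] (r : Ray T) (x : T) :
    ∃ r' : Ray T, Quotient.mk (rayEnd T) r' = Quotient.mk (rayEnd T) r ∧ r'.1 0 = x := by
  have ht : 0 ≤ dist x (r.1 0) + 1 := by positivity
  obtain ⟨r₁, hr₁, hs⟩ := r.exists_shift ht
  obtain ⟨r₂, hr₂, hx, -⟩ := r₁.exists_concat (x := x) (by
    intro t ht'
    rw [hs, hs, add_zero]
    set u := dist x (r.1 0) + 1 with hu
    have h4 := IsRTree.four_point x (r.1 u) (r.1 0) (r.1 (u + t))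
    have h1 := r.2.dist_of_le ht (by linarith : u ≤ u + t)
    have h2 := r.2.dist_zero (by linarith : 0 ≤ u + t)
    have h3 := r.2.dist_zero ht
    have h5 := dist_triangle x (r.1 u) (r.1 (u + t))
    have h6 := dist_triangle (r.1 0) x (r.1 u)
    rw [dist_comm (r.1 0) x] at h6
    rw [dist_comm (r.1 u) (r.1 0), h1, h2, h3] at h4
    rw [CHL.mem_seg]
    rcases le_max_iff.1 h4 with h | h <;> linarith)
  exact ⟨r₂, hr₂.trans hr₁, hx⟩

theorem Ray.eq_of_rel [IsRTree T] {r r' : Ray T}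
    (h : Quotient.mk (rayEnd T) r = Quotient.mk (rayEnd T) r') (h0 : r.1 0 = r'.1 0)
    {t : ℝ} (ht : 0 ≤ t) : r.1 t = r'.1 t := by
  obtain ⟨C, hC⟩ := Quotient.exact h
  have hC0 : 0 ≤ C := dist_nonneg.trans (hC 0 le_rfl)
  have htn : t ≤ 2 * t + C := by linarith
  have hn0 := ht.trans htn
  set n := 2 * t + C with hn
  have h1 := IsRTree.four_point (r'.1 t) (r.1 n) (r.1 0) (r'.1 n)
  have h2 := IsRTree.four_point (r.1 t) (r'.1 t) (r.1 0) (r.1 n)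
  have h3 := hC n hn0
  have e1 := r.2.dist_zero ht
  have e2 := r.2.dist_zero hn0
  have e3 := r'.2.dist_zero ht
  have e4 := r'.2.dist_zero hn0
  have e5 := r.2.dist_of_le ht htn
  have e6 := r'.2.dist_of_le ht htn
  rw [← h0] at e3 e4
  rw [dist_comm (r'.1 t) (r.1 0), dist_comm (r.1 n) (r.1 0), e2, e3, e4, e6] at h1
  rw [dist_comm (r'.1 t) (r.1 0), dist_comm (r.1 t) (r.1 0), e1, e2, e3, e5] at h2
  have hle : dist (r.1 t) (r'.1 t) ≤ 0 := by
    rcases le_max_iff.1 h1 with h1 | h1 <;> rcases le_max_iff.1 h2 with h2 | h2 <;> linarith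
  exact dist_le_zero.1 hle

theorem exists_ray_from [IsRTree T] (x : T) (ξ : GromovBoundary T) :
    ∃ r : Ray T, Quotient.mk (rayEnd T) r = ξ ∧ r.1 0 = x := by
  induction ξ using Quotient.inductionOn with
  | h r => exact r.exists_from x

/-- The ray from a point `x` to an end `ξ`. -/
def rayFrom [IsRTree T] (x : T) (ξ : GromovBoundary T) : Ray T :=
  (exists_ray_from x ξ).choose

theorem mk_rayFrom [IsRTree T] (x : T) (ξ : GromovBoundary T) :
    Quotient.mk (rayEnd T) (rayFrom x ξ) = ξ :=
  (exists_ray_from x ξ).choose_spec.1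

theorem rayFrom_zero [IsRTree T] (x : T) (ξ : GromovBoundary T) : (rayFrom x ξ).1 0 = x :=
  (exists_ray_from x ξ).choose_spec.2

theorem rayFrom_eq [IsRTree T] (r : Ray T) {t : ℝ} (ht : 0 ≤ t) :
    (rayFrom (r.1 0) (Quotient.mk (rayEnd T) r)).1 t = r.1 t :=
  Ray.eq_of_rel (mk_rayFrom _ _) (rayFrom_zero _ _) ht

/-! ### Segments in `T̂` -/

/-- Points of `T` going from `p` towards a point of `T̂`: constant for a point of `T`, and
following the ray from `p` for an end. -/
def towards [IsRTree T] (p : T) : TreeHat T → ℝ → T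
  | Sum.inl x => fun _ => x
  | Sum.inr ξ => (rayFrom p ξ).1

theorem towards_mem_seg [IsRTree T] (p : T) (x : TreeHat T) {s t : ℝ} (hs : 0 ≤ s)
    (hst : s ≤ t) : towards p x s ∈ seg p (towards p x t) := by
  rcases x with x | ξ
  · simp [towards, mem_seg]
  · have h := (rayFrom p ξ).2.mem_seg hs hst
    rwa [rayFrom_zero] at h

theorem segHat_symm (x y : TreeHat T) : segHat x y = segHat y x := by
  rcases x with x | ξ <;> rcases y with y | η
  · simp only [segHat, seg_symm x y]
  · rfl
  · rfl
  · have key : ∀ ξ η : GromovBoundary T, lineSeg ξ η ⊆ lineSeg η ξ := by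
      rintro ξ η z (hz | ⟨p, ⟨r, r', h1, h2, h3, h4, h5⟩, rfl⟩)
      · left
        rcases hz with hz | hz
        · exact Or.inr hz
        · exact Or.inl hz
      · refine Or.inr ⟨p, ⟨r', r, h2, h1, h4, h3, fun s t hs ht => ?_⟩, rfl⟩
        rw [dist_comm, h5 t s ht hs, add_comm]
    exact Subset.antisymm (key _ _) (key _ _)

theorem mem_segHat_symm {x y z : TreeHat T} (h : z ∈ segHat x y) : z ∈ segHat y x :=
  segHat_symm x y ▸ h

theorem left_mem_segHat [IsRTree T] (x y : TreeHat T) : x ∈ segHat x y := by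
  rcases x with x | ξ <;> rcases y with y | η
  · exact ⟨x, by simp [mem_seg], rfl⟩
  · exact Or.inr ⟨x, ⟨rayFrom x η, mk_rayFrom _ _, rayFrom_zero _ _, 0, le_rfl,
      rayFrom_zero _ _⟩, rfl⟩
  · exact Or.inl rfl
  · exact Or.inl (Or.inl rfl)

theorem right_mem_segHat [IsRTree T] (x y : TreeHat T) : y ∈ segHat x y := by
  rw [segHat_symm]
  exact left_mem_segHat y x

theorem eq_or_eq_of_inr_mem_segHat {ξ : GromovBoundary T} {x y : TreeHat T}
    (h : (Sum.inr ξ : TreeHat T) ∈ segHat x y) : Sum.inr ξ = x ∨ Sum.inr ξ = y := by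
  rcases x with x | ζ <;> rcases y with y | η
  · obtain ⟨_, _, h⟩ := h
    cases h
  · rcases h with h | ⟨_, _, h⟩
    · exact Or.inr h
    · cases h
  · rcases h with h | ⟨_, _, h⟩
    · exact Or.inl h
    · cases h
  · rcases h with h | ⟨_, _, h⟩
    · exact h
    · cases h

theorem inl_mem_raySeg_iff [IsRTree T] {p x : T} {ξ : GromovBoundary T} :
    (Sum.inl p : TreeHat T) ∈ raySeg x ξ ↔ ∃ t, 0 ≤ t ∧ (rayFrom x ξ).1 t = p := by
  constructor
  · rintro (h | ⟨q, ⟨r, rfl, rfl, t, ht, rfl⟩, hq⟩)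
    · cases h
    · cases hq
      exact ⟨t, ht, rayFrom_eq r ht⟩
  · rintro ⟨t, ht, h⟩
    exact Or.inr ⟨p, ⟨rayFrom x ξ, mk_rayFrom _ _, rayFrom_zero _ _, t, ht, h⟩, rfl⟩

theorem inl_mem_raySeg_iff_forall [IsRTree T] {p x : T} {ξ : GromovBoundary T} :
    (Sum.inl p : TreeHat T) ∈ raySeg x ξ ↔ ∀ t, 0 ≤ t → p ∈ seg x ((rayFrom p ξ).1 t) := by
  constructor
  · rintro (h | ⟨q, ⟨r, rfl, rfl, t, ht, rfl⟩, hq⟩) s hs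
    · cases h
    · cases hq
      obtain ⟨r', hr', hs'⟩ := r.exists_shift ht
      have h := rayFrom_eq r' hs
      rw [hr', hs', hs', add_zero] at h
      rw [h]
      exact r.2.mem_seg ht (by linarith)
  · intro h
    obtain ⟨r, hr, h0, hp⟩ := (rayFrom p ξ).exists_concat (x := x) (by rwa [rayFrom_zero])
    rw [rayFrom_zero] at hp
    exact Or.inr ⟨p, ⟨r, hr.trans (mk_rayFrom _ _), h0, _, dist_nonneg, hp⟩, rfl⟩

theorem inl_mem_lineSeg_iff [IsRTree T] {p : T} {ξ η : GromovBoundary T} :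
    (Sum.inl p : TreeHat T) ∈ lineSeg ξ η ↔
      ∀ t, 0 ≤ t → p ∈ seg ((rayFrom p ξ).1 t) ((rayFrom p η).1 t) := by
  have hd : ∀ (ζ : GromovBoundary T) (t : ℝ), 0 ≤ t → dist p ((rayFrom p ζ).1 t) = t := by
    intro ζ t ht
    have h := (rayFrom p ζ).2.dist_zero ht
    rwa [rayFrom_zero] at h
  constructor
  · rintro (h | ⟨q, ⟨r, r', rfl, rfl, rfl, h0, h⟩, hq⟩) t ht
    · rcases h with h | h <;> cases h
    · cases hq
      have h1 := rayFrom_eq r ht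
      have h2 := rayFrom_eq r' ht
      rw [h0] at h2
      rw [h1, h2, mem_seg, h t t ht ht, dist_comm (r.1 t), r.2.dist_zero ht, ← h0,
        r'.2.dist_zero ht]
  · intro h
    refine Or.inr ⟨p, ⟨rayFrom p ξ, rayFrom p η, mk_rayFrom _ _, mk_rayFrom _ _,
      rayFrom_zero _ _, rayFrom_zero _ _, fun s t hs ht => ?_⟩, rfl⟩
    have h1 := mem_seg_of_mem_seg (h (max s t) (le_max_of_le_left hs))
      (towards_mem_seg p (Sum.inr ξ) hs (le_max_left s t))
      (towards_mem_seg p (Sum.inr η) ht (le_max_right s t))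
    simp only [towards] at h1
    rw [mem_seg, dist_comm _ p, hd _ _ hs, hd _ _ ht] at h1
    exact h1.symm

theorem inl_mem_segHat_iff [IsRTree T] {p : T} {x y : TreeHat T} :
    (Sum.inl p : TreeHat T) ∈ segHat x y ↔
      ∀ t, 0 ≤ t → p ∈ seg (towards p x t) (towards p y t) := by
  rcases x with x | ξ <;> rcases y with y | η
  · constructor
    · rintro ⟨q, hq, h⟩ t -
      cases h
      exact hq
    · intro h
      exact ⟨p, h 0 le_rfl, rfl⟩
  · exact inl_mem_raySeg_iff_forall
  · simp only [towards, seg_symm _ y]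
    exact inl_mem_raySeg_iff_forall
  · exact inl_mem_lineSeg_iff

theorem inl_mem_segHat_inl_iff [IsRTree T] {p x : T} {y : TreeHat T} :
    (Sum.inl p : TreeHat T) ∈ segHat (Sum.inl x) y ↔
      ∃ t, 0 ≤ t ∧ ∀ s, t ≤ s → p ∈ seg x (towards x y s) := by
  rcases y with y | η
  · constructor
    · rintro ⟨q, hq, h⟩
      cases h
      exact ⟨0, le_rfl, fun _ _ => hq⟩
    · rintro ⟨t, -, h⟩
      exact ⟨p, h t le_rfl, rfl⟩
  · refine inl_mem_raySeg_iff.trans ⟨?_, ?_⟩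
    · rintro ⟨t, ht, rfl⟩
      exact ⟨t, ht, fun s hs => towards_mem_seg x (Sum.inr η) ht hs⟩
    · rintro ⟨t, ht, h⟩
      by_contra hp
      have hd := mem_seg.1 (h t le_rfl)
      simp only [towards] at hd h
      have h0 := (rayFrom x η).2.dist_zero ht
      rw [rayFrom_zero] at h0
      have hle : dist x p ≤ t := by linarith [dist_nonneg (x := p) (y := (rayFrom x η).1 t)]
      have hm := towards_mem_seg x (Sum.inr η) dist_nonneg hle
      have hp1 := (rayFrom x η).2.dist_zero (dist_nonneg (x := x) (y := p))
      rw [rayFrom_zero] at hp1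
      simp only [towards] at hm
      have h4 := IsRTree.four_point p ((rayFrom x η).1 (dist x p)) x ((rayFrom x η).1 t)
      rw [mem_seg] at hm
      rw [dist_comm p x, dist_comm _ x] at h4
      refine hp ⟨_, dist_nonneg, (dist_le_zero.1 (?_ : dist p ((rayFrom x η).1 (dist x p)) ≤ 0)).symm⟩
      rcases le_max_iff.1 h4 with h4 | h4 <;> linarith

theorem segHat_self [IsRTree T] (x : TreeHat T) : segHat x x = {x} := by
  refine Subset.antisymm (fun z hz => ?_) (singleton_subset_iff.2 (left_mem_segHat x x))
  rcases z with p | ζ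
  · have h := inl_mem_segHat_iff.1 hz 1 zero_le_one
    rw [mem_seg, dist_self] at h
    have h0 : dist p (towards p x 1) = 0 :=
      le_antisymm (by linarith [dist_nonneg (x := towards p x 1) (y := p)]) dist_nonneg
    rcases x with x | ξ
    · rw [dist_eq_zero.1 h0]
      rfl
    · have h1 := (rayFrom p ξ).2.dist_zero zero_le_one
      rw [rayFrom_zero] at h1
      exact absurd (h1.symm.trans h0) one_ne_zero
  · exact (eq_or_eq_of_inr_mem_segHat hz).elim id id

theorem eq_of_mem_segHat_self [IsRTree T] {x z : TreeHat T} (h : z ∈ segHat x x) : z = x :=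
  mem_singleton_iff.1 (segHat_self x ▸ h)

theorem segHat_subset_union [IsRTree T] (x y z : TreeHat T) :
    segHat x z ⊆ segHat x y ∪ segHat y z := by
  rintro (p | ζ) hp
  · by_contra hn
    obtain ⟨h1, h2⟩ := not_or.1 hn
    have h1' := mt inl_mem_segHat_iff.2 h1
    have h2' := mt inl_mem_segHat_iff.2 h2
    push Not at h1' h2'
    obtain ⟨s, hs, hs'⟩ := h1'
    obtain ⟨t, ht, ht'⟩ := h2'
    have h := inl_mem_segHat_iff.1 hp (max s t) (le_max_of_le_left hs)
    rcases seg_subset_union _ (towards p y (max s t)) _ h with h | h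
    · exact hs' (mem_seg_of_mem_seg h (towards_mem_seg p x hs (le_max_left s t))
        (towards_mem_seg p y hs (le_max_left s t)))
    · exact ht' (mem_seg_of_mem_seg h (towards_mem_seg p y ht (le_max_right s t))
        (towards_mem_seg p z ht (le_max_right s t)))
  · rcases eq_or_eq_of_inr_mem_segHat hp with h | h
    · left
      rw [h]
      exact left_mem_segHat x y
    · right
      rw [h]
      exact right_mem_segHat y z

theorem eq_of_mem_segHat [IsRTree T] {a b m y : TreeHat T} (hy : y ∈ segHat a b)
    (ha : m ∈ segHat y a) (hb : m ∈ segHat y b) : m = y := by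
  rcases y with y | η
  · rcases m with m | μ
    · obtain ⟨s, hs, hs'⟩ := inl_mem_segHat_inl_iff.1 ha
      obtain ⟨t, ht, ht'⟩ := inl_mem_segHat_inl_iff.1 hb
      have h := inl_mem_segHat_iff.1 hy (max s t) (le_max_of_le_left hs)
      rw [eq_of_mem_seg h (hs' _ (le_max_left s t)) (ht' _ (le_max_right s t))]
    · rcases eq_or_eq_of_inr_mem_segHat ha with h | rfl
      · exact h
      rcases eq_or_eq_of_inr_mem_segHat hb with h | rfl
      · exact h
      exact (eq_of_mem_segHat_self hy).symm
  · rcases eq_or_eq_of_inr_mem_segHat hy with rfl | rfl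
    · exact eq_of_mem_segHat_self ha
    · exact eq_of_mem_segHat_self hb

theorem segHat_subset_of_mem [IsRTree T] {a b y : TreeHat T} (hy : y ∈ segHat a b) :
    segHat y b ⊆ segHat a b := by
  intro z hz
  rcases segHat_subset_union y a b hz with h | h
  · rwa [eq_of_mem_segHat hy h hz]
  · exact h

theorem exists_inl_mem_segHat_inr [IsRTree T] (y : T) {ξ : GromovBoundary T} {z : TreeHat T}
    (hz : z ≠ Sum.inr ξ) :
    ∃ c : T, (Sum.inl c : TreeHat T) ∈ segHat (Sum.inl y) (Sum.inr ξ) ∧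
      (Sum.inl c : TreeHat T) ∈ segHat (Sum.inr ξ) z := by
  have hmem : ∀ t, 0 ≤ t → (Sum.inl ((rayFrom y ξ).1 t) : TreeHat T) ∈
      segHat (Sum.inl y) (Sum.inr ξ) := fun t ht => inl_mem_raySeg_iff.2 ⟨t, ht, rfl⟩
  have hd : ∀ (ζ : GromovBoundary T) (t : ℝ), 0 ≤ t → dist y ((rayFrom y ζ).1 t) = t := by
    intro ζ t ht
    have h := (rayFrom y ζ).2.dist_zero ht
    rwa [rayFrom_zero] at h
  by_contra! hn
  have hyz : ∀ t, 0 ≤ t → (Sum.inl ((rayFrom y ξ).1 t) : TreeHat T) ∈ segHat (Sum.inl y) z := by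
    intro t ht
    refine (segHat_subset_union _ z _ (hmem t ht)).resolve_right fun h => ?_
    exact hn _ (hmem t ht) (mem_segHat_symm h)
  rcases z with z | ζ
  · have ht : 0 ≤ dist y z + 1 := by positivity
    obtain ⟨q, hq, h⟩ := hyz _ ht
    cases h
    rw [mem_seg, hd _ _ ht] at hq
    linarith [dist_nonneg (x := (rayFrom y ξ).1 (dist y z + 1)) (y := z)]
  · refine hz (congrArg Sum.inr ?_)
    rw [← mk_rayFrom y ζ, ← mk_rayFrom y ξ]
    refine Quotient.sound ⟨0, fun t ht => ?_⟩
    obtain ⟨s, hs, h⟩ := inl_mem_raySeg_iff.1 (hyz t ht)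
    have hst : s = t := by rw [← hd ζ s hs, h, hd ξ t ht]
    rw [← h, hst, dist_self]

theorem exists_inl_mem_segHat_inr_inr [IsRTree T] {ξ : GromovBoundary T} {z : TreeHat T}
    (hz : z ≠ Sum.inr ξ) : ∃ c : T, (Sum.inl c : TreeHat T) ∈ segHat (Sum.inr ξ) z := by
  obtain ⟨r, -⟩ := Quotient.exists_rep ξ
  obtain ⟨c, -, hc⟩ := exists_inl_mem_segHat_inr (r.1 0) hz
  exact ⟨c, hc⟩

theorem exists_mem_segHat_ne [IsRTree T] {x y : TreeHat T} (h : x ≠ y) :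
    ∃ z ∈ segHat x y, z ≠ x ∧ z ≠ y := by
  have key : ∀ (x : T) (η : GromovBoundary T),
      ∃ z ∈ segHat (Sum.inl x) (Sum.inr η), z ≠ Sum.inl x ∧ z ≠ Sum.inr η := by
    intro x η
    refine ⟨Sum.inl ((rayFrom x η).1 1), inl_mem_raySeg_iff.2 ⟨1, zero_le_one, rfl⟩, ?_,
      Sum.inl_ne_inr⟩
    intro h
    have h0 := (rayFrom x η).2.dist_zero zero_le_one
    rw [rayFrom_zero, Sum.inl.inj h, dist_self] at h0
    exact zero_ne_one h0
  rcases x with x | ξ <;> rcases y with y | η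
  · have hxy : 0 < dist x y := dist_pos.2 fun e => h (congrArg Sum.inl e)
    obtain ⟨z, hz, hd⟩ := exists_mem_seg_dist_eq (x := x) (y := y) (t := dist x y / 2)
      (by linarith) (by linarith)
    refine ⟨Sum.inl z, ⟨z, hz, rfl⟩, fun e => ?_, fun e => ?_⟩
    · rw [Sum.inl.inj e, dist_self] at hd
      linarith
    · rw [Sum.inl.inj e] at hd
      linarith
  · exact key x η
  · obtain ⟨z, hz, h1, h2⟩ := key y ξ
    exact ⟨z, hz, h2, h1⟩
  · obtain ⟨c, hc⟩ := exists_inl_mem_segHat_inr_inr h.symm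
    exact ⟨Sum.inl c, hc, Sum.inl_ne_inr, Sum.inl_ne_inr⟩

/-- `m` is a median of `x`, `y`, `z`. -/
def IsMedian (x y z m : TreeHat T) : Prop :=
  m ∈ segHat x y ∧ m ∈ segHat x z ∧ m ∈ segHat y z

theorem IsMedian.swap_left {x y z m : TreeHat T} (h : IsMedian x y z m) : IsMedian y x z m :=
  ⟨segHat_symm x y ▸ h.1, h.2.2, h.2.1⟩

theorem IsMedian.swap_right {x y z m : TreeHat T} (h : IsMedian x y z m) : IsMedian x z y m :=
  ⟨h.2.1, h.1, segHat_symm y z ▸ h.2.2⟩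

theorem IsMedian.of_mem [IsRTree T] {c x y z m : TreeHat T} (h : IsMedian c y z m)
    (hy : c ∈ segHat x y) (hz : c ∈ segHat x z) : IsMedian x y z m :=
  ⟨segHat_subset_of_mem hy h.1, segHat_subset_of_mem hz h.2.1, h.2.2⟩

theorem exists_isMedian_inl_inl [IsRTree T] (x y : T) (z : TreeHat T) :
    ∃ m, IsMedian (Sum.inl x) (Sum.inl y) z m := by
  have key : ∀ z : T, ∃ m : TreeHat T, IsMedian (Sum.inl x) (Sum.inl y) (Sum.inl z) m := by
    intro z
    obtain ⟨m, h1, h2, h3⟩ := exists_median x y z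
    exact ⟨Sum.inl m, ⟨m, h1, rfl⟩, ⟨m, h2, rfl⟩, ⟨m, h3, rfl⟩⟩
  rcases z with z | ζ
  · exact key z
  · obtain ⟨c, h1, h2⟩ := exists_inl_mem_segHat_inr x (Sum.inl_ne_inr : Sum.inl y ≠ Sum.inr ζ)
    obtain ⟨m, hm⟩ := key c
    exact ⟨m, (hm.swap_right.swap_left.of_mem (mem_segHat_symm h1) h2).swap_left.swap_right⟩

theorem exists_isMedian_inl [IsRTree T] (x : T) (y z : TreeHat T) :
    ∃ m, IsMedian (Sum.inl x) y z m := by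
  rcases y with y | η
  · exact exists_isMedian_inl_inl x y z
  by_cases hz : z = Sum.inr η
  · subst hz
    exact ⟨_, right_mem_segHat _ _, right_mem_segHat _ _, left_mem_segHat _ _⟩
  · obtain ⟨c, h1, h2⟩ := exists_inl_mem_segHat_inr x hz
    obtain ⟨m, hm⟩ := exists_isMedian_inl_inl x c z
    exact ⟨m, (hm.swap_left.of_mem (mem_segHat_symm h1) h2).swap_left⟩

theorem exists_isMedian [IsRTree T] (x y z : TreeHat T) : ∃ m, IsMedian x y z m := by
  rcases x with x | ξ
  · exact exists_isMedian_inl x y z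
  by_cases hy : y = Sum.inr ξ
  · subst hy
    exact ⟨_, left_mem_segHat _ _, left_mem_segHat _ _, left_mem_segHat _ _⟩
  obtain ⟨c, hc⟩ := exists_inl_mem_segHat_inr_inr hy
  rcases segHat_subset_union _ z _ hc with h | h
  · obtain ⟨m, hm⟩ := exists_isMedian_inl c y z
    exact ⟨m, hm.of_mem hc h⟩
  · obtain ⟨m, hm⟩ := exists_isMedian_inl c (Sum.inr ξ) z
    exact ⟨m, (hm.of_mem (mem_segHat_symm hc) (mem_segHat_symm h)).swap_left⟩

theorem IsMedian.mem_segHat [IsRTree T] {x y z m w : TreeHat T} (h : IsMedian x y z m)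
    (hw : w ∈ segHat x y) : m ∈ segHat z w := by
  by_contra hn
  have hx : m ∈ segHat w x := by
    have hm := h.2.1
    rw [segHat_symm] at hm
    exact (segHat_subset_union z w x hm).resolve_left hn
  have hy : m ∈ segHat w y := by
    have hm := h.2.2
    rw [segHat_symm] at hm
    exact (segHat_subset_union z w y hm).resolve_left hn
  exact hn (eq_of_mem_segHat hw hx hy ▸ right_mem_segHat z w)

/-! ### The observers' topology -/

/-- The direction at `p` containing `x`. -/
def direction (p x : TreeHat T) : Set (TreeHat T) := {y | y ≠ p ∧ p ∉ segHat x y}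

theorem isOpen_direction {p x : TreeHat T} (h : x ≠ p) :
    IsOpen[observersTopology T] (direction p x) :=
  TopologicalSpace.isOpen_generateFrom_of_mem ⟨p, x, h, rfl⟩

theorem self_mem_direction [IsRTree T] {p x : TreeHat T} (h : x ≠ p) : x ∈ direction p x :=
  ⟨h, by rw [segHat_self]; exact h.symm⟩

theorem isClosed_segHat [IsRTree T] (x y : TreeHat T) :
    IsClosed[observersTopology T] (segHat x y) := by
  let := observersTopology T
  rw [← isOpen_compl_iff, isOpen_iff_mem_nhds]
  intro z hz
  obtain ⟨m, hm⟩ := exists_isMedian x y z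
  have hzm : z ≠ m := fun e => hz (e ▸ hm.1)
  filter_upwards [(isOpen_direction hzm).mem_nhds (self_mem_direction hzm)] with w hw hwm
  exact hw.2 (hm.mem_segHat hwm)

theorem exists_mem_segHat_forall_notMem [IsRTree T] {x y : TreeHat T} (h : x ≠ y)
    {F : Set (TreeHat T)} (hF : F.Finite) (hy : y ∉ F) :
    ∃ z ∈ segHat x y, z ≠ y ∧ ∀ p ∈ F, p ∉ segHat z y := by
  induction F, hF using Set.Finite.induction_on with
  | empty => exact ⟨x, left_mem_segHat x y, h, by simp⟩
  | @insert p F _ _ ih =>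
    rw [mem_insert_iff, not_or] at hy
    obtain ⟨z, hz, hzy, hF⟩ := ih hy.2
    by_cases hp : p ∈ segHat z y
    · obtain ⟨w, hw, hwp, hwy⟩ := exists_mem_segHat_ne (Ne.symm hy.1)
      have hsub := segHat_subset_of_mem hp
      refine ⟨w, segHat_subset_of_mem hz (hsub hw), hwy, ?_⟩
      rintro q (rfl | hq) hqw
      · exact hwp (eq_of_mem_segHat hw (right_mem_segHat w q) hqw).symm
      · exact hF q hq (hsub (segHat_subset_of_mem hw hqw))
    · refine ⟨z, hz, hzy, ?_⟩
      rintro q (rfl | hq)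
      · exact hp
      · exact hF q hq

theorem mem_closure_segHat_diff [IsRTree T] {x y : TreeHat T} (h : x ≠ y) :
    y ∈ @closure _ (observersTopology T) (segHat x y \ {y}) := by
  let := observersTopology T
  rw [(TopologicalSpace.isTopologicalBasis_of_subbasis
    (rfl : observersTopology T = _)).mem_closure_iff]
  rintro _ ⟨f, ⟨hf, hfs⟩, rfl⟩ hyf
  have : Nonempty (TreeHat T) := ⟨x⟩
  choose! P X hX hD using hfs
  obtain ⟨z, hz, hzy, hF⟩ := exists_mem_segHat_forall_notMem h (hf.image P) (by
    rintro ⟨D, hDf, hPD⟩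
    have hyD := hyf D hDf
    rw [hD hDf] at hyD
    exact hyD.1 hPD.symm)
  refine ⟨z, fun D hDf => ?_, hz, hzy⟩
  have hyD := hyf D hDf
  have hPz := hF _ (mem_image_of_mem P hDf)
  rw [hD hDf] at hyD ⊢
  refine ⟨fun e => hPz (e ▸ left_mem_segHat z y), fun hm => ?_⟩
  rcases segHat_subset_union _ y _ hm with hm | hm
  · exact hyD.2 hm
  · exact hPz (mem_segHat_symm hm)

/-- **Lemma 2.2.**  If a sequence of points `Pₙ` of `T̂` converges in the observers'
topology to `P ∈ T̂`, then for every base point `Q ∈ T̂` the closure of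
`⋃_{m≥0} ⋂_{n≥m} [Q,Pₙ]` is the segment `[Q,P]`; that is, `P = liminf_Q Pₙ`. -/
theorem obs_limit_is_liminf (T : Type) [MetricSpace T] [CompleteSpace T] [IsRTree T]
    (P : ℕ → TreeHat T) (L : TreeHat T)
    (h : Filter.Tendsto P Filter.atTop (@nhds _ (observersTopology T) L))
    (Q : TreeHat T) :
    @closure _ (observersTopology T)
        (⋃ m : ℕ, ⋂ n : ℕ, ⋂ _ : m ≤ n, segHat Q (P n)) = segHat Q L := by
  let := observersTopology T
  have hmem : ∀ z, (z ∈ ⋃ m : ℕ, ⋂ n : ℕ, ⋂ _ : m ≤ n, segHat Q (P n)) ↔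
      ∀ᶠ n in atTop, z ∈ segHat Q (P n) := by
    intro z
    simp [eventually_atTop]
  refine Subset.antisymm (closure_minimal (fun z hz => ?_) (isClosed_segHat Q L)) ?_
  · by_contra hn
    have hQ : Q ≠ z := fun e => hn (e ▸ left_mem_segHat Q L)
    have hL : L ≠ z := fun e => hn (e ▸ right_mem_segHat Q L)
    have hev := h ((isOpen_direction hQ).mem_nhds ⟨hL, hn⟩)
    obtain ⟨n, hn1, hn2⟩ := (((hmem z).1 hz).and hev).exists
    exact hn2.2 hn1
  · have hsub : segHat Q L \ {L} ⊆ ⋃ m : ℕ, ⋂ n : ℕ, ⋂ _ : m ≤ n, segHat Q (P n) := by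
      rintro z ⟨hz, hzL⟩
      rw [hmem]
      have hL : L ≠ z := fun e => hzL e.symm
      filter_upwards [h ((isOpen_direction hL).mem_nhds (self_mem_direction hL))] with n hn
      refine (segHat_subset_union Q (P n) L hz).resolve_right fun hm => hn.2 ?_
      rwa [segHat_symm]
    intro z hz
    by_cases hzL : z = L
    · subst hzL
      by_cases hQ : Q = z
      · subst hQ
        exact subset_closure ((hmem Q).2 (Eventually.of_forall fun n => left_mem_segHat Q (P n)))
      · exact closure_mono hsub (mem_closure_segHat_diff hQ)
    · exact subset_closure (hsub ⟨hz, hzL⟩)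

end CHL
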